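/- Let k ≥ 1 be an integer and ℓ > 1. Then there exists C₀ > 0 such that for every N > 0 and every δ ∈ (0,1) there exist a smooth function f : ℝ → ℝ with supp f ⊆ [−1,1], satisfying ∫_ℝ |f| ≤ C₀ and |f′(x)| ≤ C₀·|x|^{−ℓ} for all x ≠ 0, and a bounded interval I with 0 < |I| < δ such that (1/|I|)∫_I |φ_*(M f) − (φ_*(M f))_I| > N·φ(|I|). -/

import Mathlib

open MeasureTheory Set

/-- The uncentered Hardy–Littlewood maximal function over bounded intervals. -/
noncomputable def maxFun1 (g : ℝ → ℝ) (x : ℝ) : ℝ :=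
  sSup {A | ∃ a b : ℝ, a < b ∧ x ∈ Set.Ioo a b ∧ A = ⨍ y in Set.Ioo a b, |g y|}

/-- `φ_*(x) = ln^{[k]} |ln x|`. -/
noncomputable def phiStar (k : ℕ) (x : ℝ) : ℝ := Real.log^[k] |Real.log x|

/-- `φ(x) = -x (φ_*)'(x)`. -/
noncomputable def phiW (k : ℕ) (x : ℝ) : ℝ := -x * deriv (phiStar k) x

lemma strictMonoOn_iterate_log (j : ℕ) :
    StrictMonoOn (Real.log^[j + 1]) (Ioi (Real.exp^[j] 0)) := by
  induction j with
  | zero => simpa using Real.strictMonoOn_log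
  | succ j ih =>
    intro s hs t ht hst
    rw [Function.iterate_succ_apply', mem_Ioi] at hs ht
    have hs0 := (Real.exp_pos _).trans hs
    rw [Function.iterate_succ_apply, Function.iterate_succ_apply Real.log (j + 1) t]
    exact ih ((Real.lt_log_iff_exp_lt hs0).2 hs)
      ((Real.lt_log_iff_exp_lt (hs0.trans hst)).2 ht) (Real.log_lt_log hs0 hst)

lemma iterate_log_iterate_exp (k : ℕ) (x : ℝ) : Real.log^[k] (Real.exp^[k] x) = x :=
  Function.LeftInverse.iterate Real.log_exp k x

lemma measurable_phiStar (k : ℕ) : Measurable (phiStar k) :=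
  (Real.measurable_log.iterate k).comp Real.measurable_log.abs

section MaxFun

variable {g : ℝ → ℝ} {A : ℝ}

lemma setAverage_abs_le (hg : ∀ x, |g x| ≤ A) {a b : ℝ} (hab : a < b) :
    ⨍ y in Ioo a b, |g y| ≤ A := by
  rw [setAverage_eq, Real.volume_real_Ioo_of_le hab.le, smul_eq_mul,
    inv_mul_le_iff₀ (sub_pos.2 hab)]
  have h := norm_setIntegral_le_of_norm_le_const (μ := volume) (s := Ioo a b)
    (f := fun y => |g y|) (C := A) (by simp) (fun x _ => by simpa using hg x)
  rw [Real.volume_real_Ioo_of_le hab.le] at h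
  linarith [Real.le_norm_self (∫ y in Ioo a b, |g y|)]

lemma bddAbove_setAverage_abs (hg : ∀ x, |g x| ≤ A) (x : ℝ) :
    BddAbove {m | ∃ a b : ℝ, a < b ∧ x ∈ Ioo a b ∧ m = ⨍ y in Ioo a b, |g y|} := by
  refine ⟨A, ?_⟩
  rintro _ ⟨a, b, hab, -, rfl⟩
  exact setAverage_abs_le hg hab

lemma setAverage_abs_le_maxFun1 (hg : ∀ x, |g x| ≤ A) {a b x : ℝ} (hx : x ∈ Ioo a b) :
    ⨍ y in Ioo a b, |g y| ≤ maxFun1 g x :=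
  le_csSup (bddAbove_setAverage_abs hg x) ⟨a, b, hx.1.trans hx.2, hx, rfl⟩

lemma maxFun1_le {x B : ℝ} (h : ∀ a b, x ∈ Ioo a b → ⨍ y in Ioo a b, |g y| ≤ B) :
    maxFun1 g x ≤ B := by
  refine csSup_le ⟨_, x - 1, x + 1, by linarith, ⟨by linarith, by linarith⟩, rfl⟩ ?_
  rintro _ ⟨a, b, -, hx, rfl⟩
  exact h a b hx

lemma lowerSemicontinuous_maxFun1 (hg : ∀ x, |g x| ≤ A) : LowerSemicontinuous (maxFun1 g) := by
  intro x t ht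
  have hne : {m | ∃ a b : ℝ, a < b ∧ x ∈ Ioo a b ∧ m = ⨍ y in Ioo a b, |g y|}.Nonempty :=
    ⟨_, x - 1, x + 1, by linarith, ⟨by linarith, by linarith⟩, rfl⟩
  obtain ⟨_, ⟨a, b, -, hx, rfl⟩, hm⟩ := exists_lt_of_lt_csSup hne ht
  filter_upwards [isOpen_Ioo.mem_nhds hx] with y hy
  exact hm.trans_le (setAverage_abs_le_maxFun1 hg hy)

lemma le_maxFun1_of_plateau (hc : Continuous g) (hg : ∀ x, |g x| ≤ A) {c d a b x : ℝ}
    (hcd : c ≤ d) (hca : a ≤ c) (hdb : d ≤ b) (h : ∀ y ∈ Ioo c d, |g y| = A)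
    (hx : x ∈ Ioo a b) : A * ((d - c) / (b - a)) ≤ maxFun1 g x := by
  refine le_trans ?_ (setAverage_abs_le_maxFun1 hg hx)
  have hab := hx.1.trans hx.2
  rw [setAverage_eq, Real.volume_real_Ioo_of_le hab.le, smul_eq_mul]
  have h1 : ∫ y in Ioo c d, |g y| = A * (d - c) := by
    rw [setIntegral_congr_fun measurableSet_Ioo h, setIntegral_const,
      Real.volume_real_Ioo_of_le hcd, smul_eq_mul, mul_comm]
  have h2 : ∫ y in Ioo c d, |g y| ≤ ∫ y in Ioo a b, |g y| :=
    setIntegral_mono_set ((hc.abs.integrableOn_Icc (a := a) (b := b)).mono_set Ioo_subset_Icc_self)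
      (ae_of_all _ fun _ => abs_nonneg _) (Ioo_subset_Ioo hca hdb).eventuallyLE
  have h3 : 0 ≤ (b - a)⁻¹ := inv_nonneg.2 (sub_nonneg.2 hab.le)
  calc A * ((d - c) / (b - a)) = (b - a)⁻¹ * (A * (d - c)) := by ring
    _ ≤ _ := by gcongr; linarith

lemma maxFun1_le_off_support (hg : ∀ x, |g x| ≤ A) {r x : ℝ} (hr : 0 < r)
    (h : ∀ y, 2 * r ≤ |y| → g y = 0) (hx : 3 * r ≤ x) : maxFun1 g x ≤ 4 / 5 * A := by
  have hA : 0 ≤ A := (abs_nonneg _).trans (hg 0)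
  refine maxFun1_le fun a b hxab => ?_
  have hab := hxab.1.trans hxab.2
  have hb := hxab.2
  rw [setAverage_eq, Real.volume_real_Ioo_of_le hab.le, smul_eq_mul,
    inv_mul_le_iff₀ (sub_pos.2 hab)]
  have h1 : ∫ y in Ioo (max a (-(2 * r))) (2 * r), |g y| = ∫ y in Ioo a b, |g y| := by
    refine setIntegral_eq_of_subset_of_forall_sdiff_eq_zero measurableSet_Ioo ?_ ?_ |>.symm
    · exact Ioo_subset_Ioo (le_max_left _ _) (by linarith)
    · intro y hy
      rw [h y, abs_zero]
      by_contra! hlt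
      exact hy.2 ⟨max_lt hy.1.1 (abs_lt.1 hlt).1, (abs_lt.1 hlt).2⟩
  have h2 := norm_setIntegral_le_of_norm_le_const (μ := volume)
    (s := Ioo (max a (-(2 * r))) (2 * r))
    (f := fun y => |g y|) (C := A) (by simp) (fun x _ => by simpa using hg x)
  rw [Real.volume_real_Ioo, h1] at h2
  have h3 : max (2 * r - max a (-(2 * r))) 0 ≤ 4 / 5 * (b - a) := by
    refine max_le ?_ (by linarith)
    rcases le_total (5 * r) (b - a) with h5 | h5
    · linarith [le_max_right a (-(2 * r))]
    · linarith [le_max_left a (-(2 * r))]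
  have h4 := mul_le_mul_of_nonneg_left h3 hA
  linarith [Real.le_norm_self (∫ y in Ioo a b, |g y|)]

end MaxFun

/-- A function equal to `-K` on the first quarter of an interval and at least `B` on the last
quarter has mean oscillation at least `(B + K) / 4`. -/
lemma le_mean_oscillation {h : ℝ → ℝ} {r K B : ℝ} (hr : 0 < r)
    (hh_int : IntegrableOn h (Ioo 0 (4 * r))) (hl : ∀ x ∈ Ioo 0 r, h x = -K)
    (hR : ∀ x ∈ Ioo (3 * r) (4 * r), B ≤ h x) (c : ℝ) :
    (B + K) / 4 ≤ ⨍ x in Ioo 0 (4 * r), |h x - c| := by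
  have hi : IntegrableOn (fun x => |h x - c|) (Ioo 0 (4 * r)) :=
    (hh_int.sub (integrableOn_const measure_Ioo_lt_top.ne)).abs
  have hsl : Ioo 0 r ⊆ Ioo 0 (4 * r) := Ioo_subset_Ioo le_rfl (by linarith)
  have hsR : Ioo (3 * r) (4 * r) ⊆ Ioo 0 (4 * r) := Ioo_subset_Ioo (by linarith) le_rfl
  have hdisj : Disjoint (Ioo 0 r) (Ioo (3 * r) (4 * r)) :=
    Set.disjoint_left.2 fun x hx hx' => by linarith [hx.2, hx'.1]
  have h1 : ∫ x in Ioo 0 r ∪ Ioo (3 * r) (4 * r), |h x - c| ≤ ∫ x in Ioo 0 (4 * r), |h x - c| :=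
    setIntegral_mono_set hi (ae_of_all _ fun _ => abs_nonneg _)
      (union_subset hsl hsR).eventuallyLE
  rw [setIntegral_union hdisj measurableSet_Ioo (hi.mono_set hsl) (hi.mono_set hsR)] at h1
  have h2 : ∫ _ in Ioo 0 r, (K + c) ≤ ∫ x in Ioo 0 r, |h x - c| :=
    setIntegral_mono_on (integrableOn_const (by simp)) (hi.mono_set hsl) measurableSet_Ioo
      fun x hx => by rw [hl x hx]; linarith [neg_abs_le (-K - c)]
  have h3 : ∫ _ in Ioo (3 * r) (4 * r), (B - c) ≤ ∫ x in Ioo (3 * r) (4 * r), |h x - c| :=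
    setIntegral_mono_on (integrableOn_const (by simp)) (hi.mono_set hsR) measurableSet_Ioo
      fun x hx => by linarith [hR x hx, le_abs_self (h x - c)]
  rw [setIntegral_const, Real.volume_real_Ioo_of_le (by linarith), smul_eq_mul] at h2 h3
  rw [setAverage_eq, Real.volume_real_Ioo_of_le (by linarith), smul_eq_mul,
    le_inv_mul_iff₀ (by linarith)]
  nlinarith

lemma exists_smooth_plateau : ∃ (g : ℝ → ℝ) (C : ℝ), ContDiff ℝ (⊤ : ℕ∞) g ∧ 0 < C ∧
    (∀ x, 0 ≤ g x) ∧ (∀ x, g x ≤ 1) ∧ (∀ x, |x| ≤ 1 → g x = 1) ∧ (∀ x, 2 ≤ |x| → g x = 0) ∧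
    (∀ x, |deriv g x| ≤ C) ∧ ∀ x, 2 < |x| → deriv g x = 0 := by
  let b : ContDiffBump (0 : ℝ) := ⟨1, 2, one_pos, one_lt_two⟩
  have hb : ContDiff ℝ (⊤ : ℕ∞) b := b.contDiff
  obtain ⟨C, hC⟩ := (hb.continuous_deriv (by simp)).bounded_above_of_compact_support
    b.hasCompactSupport.deriv
  refine ⟨b, max C 1, hb, by positivity, fun x => b.nonneg, fun x => b.le_one,
    fun x hx => b.one_of_mem_closedBall (by simpa using hx),
    fun x hx => b.zero_of_le_dist (by simpa using hx),
    fun x => (hC x).trans (le_max_left _ _), fun x hx => ?_⟩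
  refine (Filter.EventuallyEq.deriv_eq (f := fun _ => (0 : ℝ)) ?_).trans (deriv_const _ _)
  filter_upwards [(isOpen_lt continuous_const continuous_abs).mem_nhds hx] with y hy
  exact b.zero_of_le_dist (by simpa using le_of_lt hy)

/-- second Corollary after Theorem A.4: uniform `L¹` and gradient
bounds do not give a uniform `bmo~_φ` bound on `φ_*(Mf)`. -/
theorem stmt_9 (k : ℕ) (hk : 1 ≤ k) (ℓ : ℝ) (hℓ : 1 < ℓ) :
    ∃ C₀ > (0 : ℝ), ∀ N > (0 : ℝ), ∀ δ ∈ Set.Ioo (0 : ℝ) 1,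
      ∃ f : ℝ → ℝ, ContDiff ℝ (⊤ : ℕ∞) f ∧ Function.support f ⊆ Set.Icc (-1) 1 ∧
        (∫ x : ℝ, |f x|) ≤ C₀ ∧
        (∀ x : ℝ, x ≠ 0 → |deriv f x| ≤ C₀ * |x| ^ (-ℓ)) ∧
        ∃ a b : ℝ, a < b ∧ b - a < δ ∧
          N * phiW k (b - a) <
            ⨍ x in Set.Ioo a b, |phiStar k (maxFun1 f x) -
              ⨍ y in Set.Ioo a b, phiStar k (maxFun1 f y)| := by
  obtain ⟨j, rfl⟩ : ∃ j, k = j + 1 := ⟨k - 1, by omega⟩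
  obtain ⟨g, C, hgs, hC, hg0, hg1, hgp, hgz, hgd, hgdz⟩ := exists_smooth_plateau
  refine ⟨2 * C + 2, by positivity, fun N _ δ hδ => ?_⟩
  obtain ⟨r, hr⟩ : ∃ r, r = δ / 8 := ⟨_, rfl⟩
  have hr0 : 0 < r := by linarith [hδ.1]
  have hr1 : r < 1 / 8 := by linarith [hδ.2]
  have hφ := strictMonoOn_iterate_log j
  set T := Real.exp^[j] 0 with hT
  have hT0 : 0 ≤ T := by
    rw [hT]; cases j with
    | zero => simp
    | succ j => rw [Function.iterate_succ_apply']; positivity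
  have hlog54 : 0 < Real.log (5 / 4) := Real.log_pos (by norm_num)
  obtain ⟨B, hB⟩ : ∃ B, B = Real.log^[j + 1] (T + Real.log (5 / 4)) := ⟨_, rfl⟩
  -- The height `exp (-t)` of the plateau is tuned so that `phiStar` equals `-K` on it.
  obtain ⟨K, hK⟩ : ∃ K, K = 4 * (N * phiW (j + 1) (4 * r)) - B + 4 := ⟨_, rfl⟩
  obtain ⟨t, ht⟩ : ∃ t, t = Real.exp^[j + 1] (-K) := ⟨_, rfl⟩
  have htT : T < t := by
    rw [ht, Function.iterate_succ_apply]
    exact Real.exp_strictMono.iterate j (Real.exp_pos _)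
  have htK : Real.log^[j + 1] t = -K := by rw [ht, iterate_log_iterate_exp]
  obtain ⟨A, hA⟩ : ∃ A, A = Real.exp (-t) := ⟨_, rfl⟩
  have hA0 : 0 < A := hA ▸ Real.exp_pos _
  have hA1 : A ≤ 1 := by rw [hA]; exact Real.exp_le_one_iff.2 (by linarith)
  have hlogA : Real.log A = -t := by rw [hA, Real.log_exp]
  have hφmono : ∀ {x y : ℝ}, 0 < x → x ≤ y → y ≤ A →
      phiStar (j + 1) y ≤ phiStar (j + 1) x := by
    intro x y hx hxy hyA
    have h1 := Real.log_le_log hx hxy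
    have h2 := Real.log_le_log (hx.trans_le hxy) hyA
    unfold phiStar
    rw [abs_of_neg (by linarith), abs_of_neg (by linarith)]
    exact hφ.monotoneOn (mem_Ioi.2 (by linarith)) (mem_Ioi.2 (by linarith)) (by linarith)
  have hφA : phiStar (j + 1) A = -K := by
    unfold phiStar
    rw [hlogA, abs_neg, abs_of_pos (by linarith), htK]
  have hφB : B ≤ phiStar (j + 1) (4 / 5 * A) := by
    have : Real.log (4 / 5 * A) = -(t + Real.log (5 / 4)) := by
      rw [Real.log_mul (by norm_num) hA0.ne', hlogA, show (4 / 5 : ℝ) = (5 / 4)⁻¹ by norm_num,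
        Real.log_inv]
      ring
    unfold phiStar
    rw [this, abs_neg, abs_of_pos (by linarith), hB]
    exact hφ.monotoneOn (mem_Ioi.2 (by linarith)) (mem_Ioi.2 (by linarith)) (by linarith)
  obtain ⟨f, hf⟩ : ∃ f : ℝ → ℝ, f = fun x => A * g (x / r) := ⟨_, rfl⟩
  have hfs : ContDiff ℝ (⊤ : ℕ∞) f := by
    rw [hf]; exact contDiff_const.mul (hgs.comp (contDiff_id.div_const r))
  have habs : ∀ x, |f x| = A * g (x / r) := fun x => by
    rw [hf]; exact abs_of_nonneg (mul_nonneg hA0.le (hg0 _))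
  have hfA : ∀ x, |f x| ≤ A := fun x => by
    rw [habs]; exact mul_le_of_le_one_right hA0.le (hg1 _)
  have hfp : ∀ x, |x| ≤ r → |f x| = A := fun x hx => by
    rw [habs, hgp, mul_one]
    rwa [abs_div, abs_of_pos hr0, div_le_one hr0]
  have hfz : ∀ x, 2 * r ≤ |x| → f x = 0 := fun x hx => by
    rw [hf]
    simp only
    rw [hgz, mul_zero]
    rwa [abs_div, abs_of_pos hr0, le_div_iff₀ hr0]
  have hsupp : Function.support f ⊆ Icc (-1) 1 := fun x hx => by
    refine abs_le.1 ?_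
    by_contra! h
    exact hx (hfz x (by linarith))
  refine ⟨f, hfs, hsupp, ?_, ?_, 0, 4 * r, by linarith, by linarith [hδ.1], ?_⟩
  · have h1 : ∫ x in Icc (-1) 1, |f x| = ∫ x, |f x| :=
      setIntegral_eq_integral_of_forall_compl_eq_zero fun x hx => by
        rw [Function.notMem_support.1 fun h => hx (hsupp h), abs_zero]
    have h2 := norm_setIntegral_le_of_norm_le_const (μ := volume) (s := Icc (-1 : ℝ) 1)
      (f := fun y => |f y|) (C := A) (by simp) (fun x _ => by simpa using hfA x)
    rw [Real.volume_real_Icc_of_le (by norm_num), h1] at h2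
    linarith [Real.le_norm_self (∫ x, |f x|)]
  · intro x hx
    have hd : deriv f x = A * (deriv g (x / r) / r) := by
      have hgd' := (hgs.differentiable (by simp) (x / r)).hasDerivAt
      have := (hgd'.comp x ((hasDerivAt_id x).div_const r)).const_mul A
      rw [hf]
      refine this.deriv.trans ?_
      ring
    have hx0 : 0 < |x| := abs_pos.2 hx
    rcases lt_or_ge (2 * r) |x| with h | h
    · rw [hd, hgdz, zero_div, mul_zero, abs_zero]
      · positivity
      · rwa [abs_div, abs_of_pos hr0, lt_div_iff₀ hr0]
    · have h1 : |x|⁻¹ ≤ |x| ^ (-ℓ) := by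
        rw [← Real.rpow_neg_one]
        exact Real.rpow_le_rpow_of_exponent_ge hx0 (by linarith) (by linarith)
      have h2 : r⁻¹ ≤ 2 * |x|⁻¹ := by
        rw [← div_eq_mul_inv, le_div_iff₀ hx0, inv_mul_le_iff₀ hr0]
        linarith
      calc |deriv f x| = A * (|deriv g (x / r)| * r⁻¹) := by
            rw [hd, abs_mul, abs_div, abs_of_pos hA0, abs_of_pos hr0, div_eq_mul_inv]
        _ ≤ 1 * (C * (2 * |x|⁻¹)) := by
            gcongr
            exact hgd _
        _ ≤ (2 * C + 2) * |x|⁻¹ := by nlinarith [inv_pos.2 hx0]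
        _ ≤ (2 * C + 2) * |x| ^ (-ℓ) := by gcongr
  · have hMle : ∀ x, maxFun1 f x ≤ A := fun x =>
      maxFun1_le fun a b hx => setAverage_abs_le hfA (hx.1.trans hx.2)
    have hMp : ∀ x ∈ Ioo 0 r, maxFun1 f x = A := fun x hx => by
      refine le_antisymm (hMle x) ?_
      have := le_maxFun1_of_plateau hfs.continuous hfA hr0.le le_rfl le_rfl
        (fun y hy => hfp y (by rw [abs_of_pos hy.1]; exact hy.2.le)) hx
      rwa [div_self (by linarith), mul_one] at this
    have hMlow : ∀ x ∈ Ioo 0 (4 * r), A / 4 ≤ maxFun1 f x := fun x hx => by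
      have := le_maxFun1_of_plateau hfs.continuous hfA hr0.le le_rfl (by linarith)
        (fun y hy => hfp y (by rw [abs_of_pos hy.1]; exact hy.2.le)) hx
      rwa [show (r - 0) / (4 * r - 0) = 1 / 4 by field_simp; ring, mul_one_div] at this
    have hpos : ∀ x ∈ Ioo 0 (4 * r), 0 < maxFun1 f x := fun x hx =>
      lt_of_lt_of_le (by positivity) (hMlow x hx)
    have hh_int : IntegrableOn (fun x => phiStar (j + 1) (maxFun1 f x)) (Ioo 0 (4 * r)) := by
      refine Measure.integrableOn_of_bounded (M := |-K| + |phiStar (j + 1) (A / 4)|)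
        measure_Ioo_lt_top.ne
        ((measurable_phiStar _).comp
          (lowerSemicontinuous_maxFun1 hfA).measurable).aestronglyMeasurable ?_
      refine (ae_restrict_iff' measurableSet_Ioo).2 (ae_of_all _ fun x hx => ?_)
      have h1 := hφmono (hpos x hx) (hMle x) le_rfl
      have h2 := hφmono (by positivity) (hMlow x hx) (hMle x)
      rw [hφA] at h1
      refine abs_le.2 ⟨?_, ?_⟩
      · linarith [neg_abs_le (-K), abs_nonneg (phiStar (j + 1) (A / 4))]
      · linarith [abs_nonneg (-K), le_abs_self (phiStar (j + 1) (A / 4))]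
    have hosc := le_mean_oscillation hr0 hh_int
      (fun x hx => (congrArg _ (hMp x hx)).trans hφA)
      (fun x hx => hφB.trans (hφmono (hpos x ⟨by linarith [hx.1], hx.2⟩)
        (maxFun1_le_off_support hfA hr0 hfz hx.1.le) (by linarith)))
      (⨍ y in Ioo 0 (4 * r), phiStar (j + 1) (maxFun1 f y))
    refine lt_of_lt_of_le ?_ hosc
    rw [sub_zero]
    linarith
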